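/- Let ω : B⁴₊ → ℝ be of class C³ up to the boundary of the closed half-ball, with Δ²ω = 0 in the interior of B⁴₊, (1/2)μ_M(Δω) + Δ_{S³}(μ_M ω) − Δ_{S³}(ω|_M) = 0 on M \ Σ, (1/2)μ_N(Δω) + Δ_{ℝ³}(μ_N ω) = 0 on N \ Σ, μ_M ω = 0 on M, μ_N ω = 0 on N, and ω = 0 on Σ. Then ω ≡ 0 on B⁴₊. -/

import Mathlib

noncomputable section

open Real Set
open scoped RealInnerProductSpace Topology

abbrev E4 := EuclideanSpace ℝ (Fin 4)

def e4 (i : Fin 4) : E4 := EuclideanSpace.single i 1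

/-- Euclidean Laplacian on `ℝ⁴`. -/
def lap (u : E4 → ℝ) (x : E4) : ℝ :=
  ∑ i : Fin 4, fderiv ℝ (fun y => fderiv ℝ u y (e4 i)) x (e4 i)

/-- Laplacian in the first three variables. -/
def lap3 (u : E4 → ℝ) (x : E4) : ℝ :=
  ∑ i : Fin 3, fderiv ℝ (fun y => fderiv ℝ u y (e4 i.castSucc)) x (e4 i.castSucc)

/-- Spherical Laplacian of (the restriction to `S³` of) `f`, via the `0`-homogeneous
extension `y ↦ f (y / ‖y‖)`. -/
def sphLap (f : E4 → ℝ) (x : E4) : ℝ := lap (fun y => f (‖y‖⁻¹ • y)) x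

/-- Inward normal derivative at a point of the unit sphere: `μ_M u x = -⟨∇u x, x⟩`. -/
def muM (u : E4 → ℝ) (x : E4) : ℝ := -(fderiv ℝ u x x)

/-- Inward normal derivative at a point of the flat boundary `B³ ⊂ {x₄ = 0}`. -/
def muN (u : E4 → ℝ) (x : E4) : ℝ := fderiv ℝ u x (e4 3)

/-- At `p ∈ Σ`, `ν_M f p = -(d/dφ)|_{φ = π/2} f(sin φ • σ, cos φ)`. -/
def nuM (f : E4 → ℝ) (p : E4) : ℝ :=
  -(deriv (fun t : ℝ => f (Real.sin t • p + Real.cos t • e4 3)) (π/2))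

/-- At `p ∈ Σ`, `ν_N f p = -(d/dr)|_{r = 1} f (r • p)`. -/
def nuN (f : E4 → ℝ) (p : E4) : ℝ := -(deriv (fun r : ℝ => f (r • p)) 1)

/-- The closed upper half-ball `B⁴₊`. -/
def B4p : Set E4 := {x | ‖x‖ ≤ 1 ∧ 0 ≤ x 3}
/-- The upper half-sphere `M = S³₊`. -/
def Mhs : Set E4 := {x | ‖x‖ = 1 ∧ 0 ≤ x 3}
/-- The flat boundary `N = B³`. -/
def Nfb : Set E4 := {x | ‖x‖ ≤ 1 ∧ x 3 = 0}
/-- The corner `Σ = S²`. -/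
def Sig : Set E4 := {x | ‖x‖ = 1 ∧ x 3 = 0}

/-- `P₃^M u = (1/2) μ_M (Δu) + Δ_{S³}(μ_M u) - Δ_{S³}(u|_M)`. -/
def P3M (u : E4 → ℝ) (x : E4) : ℝ :=
  (1/2) * muM (lap u) x + sphLap (muM u) x - sphLap u x

/-- `P₃^N u = (1/2) μ_N (Δu) + Δ_{ℝ³}(μ_N u)`. -/
def P3N (u : E4 → ℝ) (x : E4) : ℝ :=
  (1/2) * muN (lap u) x + lap3 (muN u) x


/-- The `i`-th partial derivative. -/
def pd (i : Fin 4) (u : E4 → ℝ) : E4 → ℝ := fun y => fderiv ℝ u y (e4 i)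

lemma e4_apply (i j : Fin 4) : e4 i j = if j = i then 1 else 0 := by
  simp [e4]

lemma lap_eq_sum_pd (u : E4 → ℝ) (x : E4) : lap u x = ∑ i, pd i (pd i u) x := rfl

lemma eq_sum_smul_e4 (x : E4) : x = ∑ j, x j • e4 j := by
  ext i
  fin_cases i <;> simp [Fin.sum_univ_four, e4_apply]

lemma fderiv_apply_eq_sum_pd (u : E4 → ℝ) (x d : E4) :
    fderiv ℝ u x d = ∑ j, d j * pd j u x := by
  conv_lhs => rw [eq_sum_smul_e4 d]
  simp [pd]

lemma contDiffAt_pd {u : E4 → ℝ} {x : E4} {n m : WithTop ℕ∞} (h : ContDiffAt ℝ n u x)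
    (hmn : m + 1 ≤ n) (i : Fin 4) : ContDiffAt ℝ m (pd i u) x :=
  (h.fderiv_right hmn).clm_apply contDiffAt_const

lemma contDiff_pd {u : E4 → ℝ} {n m : WithTop ℕ∞} (h : ContDiff ℝ n u)
    (hmn : m + 1 ≤ n) (i : Fin 4) : ContDiff ℝ m (pd i u) :=
  (h.fderiv_right hmn).clm_apply contDiff_const

lemma contDiffAt_lap {u : E4 → ℝ} {x : E4} {n m : WithTop ℕ∞} (h : ContDiffAt ℝ n u x)
    (hmn : m + 1 + 1 ≤ n) : ContDiffAt ℝ m (lap u) x :=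
  ContDiffAt.sum fun i _ => contDiffAt_pd (contDiffAt_pd h hmn i) le_rfl i

lemma contDiff_lap {u : E4 → ℝ} {n m : WithTop ℕ∞} (h : ContDiff ℝ n u)
    (hmn : m + 1 + 1 ≤ n) : ContDiff ℝ m (lap u) :=
  contDiff_iff_contDiffAt.2 fun _ => contDiffAt_lap h.contDiffAt hmn

lemma fderiv_fderiv_apply {u : E4 → ℝ} (h : ContDiff ℝ 2 u) (x a b : E4) :
    fderiv ℝ (fun y => fderiv ℝ u y a) x b = fderiv ℝ (fderiv ℝ u) x b a := by
  have h1 : DifferentiableAt ℝ (fderiv ℝ u) x :=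
    (h.fderiv_right (m := 1) (by norm_num)).differentiable (by norm_num) x
  simp [fderiv_clm_apply h1 (differentiableAt_const a)]

lemma fderiv_fderiv_comm {u : E4 → ℝ} (h : ContDiff ℝ 2 u) (x a b : E4) :
    fderiv ℝ (fderiv ℝ u) x a b = fderiv ℝ (fderiv ℝ u) x b a :=
  (h.contDiffAt.isSymmSndFDerivAt (by simp)) a b

lemma pd_comm {u : E4 → ℝ} (h : ContDiff ℝ 2 u) (i j : Fin 4) :
    pd i (pd j u) = pd j (pd i u) := by
  ext x
  unfold pd
  rw [fderiv_fderiv_apply h, fderiv_fderiv_apply h, fderiv_fderiv_comm h]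

lemma pd_add {u v : E4 → ℝ} {x : E4} (hu : DifferentiableAt ℝ u x)
    (hv : DifferentiableAt ℝ v x) (i : Fin 4) :
    pd i (fun y => u y + v y) x = pd i u x + pd i v x := by
  simp [pd, fderiv_fun_add hu hv]

lemma pd_sub {u v : E4 → ℝ} {x : E4} (hu : DifferentiableAt ℝ u x)
    (hv : DifferentiableAt ℝ v x) (i : Fin 4) :
    pd i (fun y => u y - v y) x = pd i u x - pd i v x := by
  simp [pd, fderiv_fun_sub hu hv]

lemma pd_sum {u : Fin 4 → E4 → ℝ} {x : E4} (hu : ∀ j, DifferentiableAt ℝ (u j) x)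
    (i : Fin 4) : pd i (fun y => ∑ j, u j y) x = ∑ j, pd i (u j) x := by
  simp [pd, fderiv_fun_sum fun j _ => hu j]

lemma pd_mul {u v : E4 → ℝ} {x : E4} (hu : DifferentiableAt ℝ u x)
    (hv : DifferentiableAt ℝ v x) (i : Fin 4) :
    pd i (fun y => u y * v y) x = pd i u x * v x + u x * pd i v x := by
  simp [pd, fderiv_fun_mul hu hv]
  ring

lemma pd_neg (u : E4 → ℝ) (i : Fin 4) : pd i (fun y => -u y) = fun y => -pd i u y := by
  ext x
  simp [pd, fderiv_fun_neg]

lemma lap_neg (u : E4 → ℝ) (x : E4) : lap (fun y => -u y) x = -lap u x := by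
  simp [lap_eq_sum_pd, pd_neg]

lemma pd_const (c : ℝ) (i : Fin 4) (x : E4) : pd i (fun _ => c) x = 0 := by
  simp [pd]

lemma differentiable_coord (j : Fin 4) : Differentiable ℝ (fun y : E4 => y j) := by
  fun_prop

lemma pd_coord (i j : Fin 4) (x : E4) :
    pd i (fun y => y j) x = if j = i then 1 else 0 := by
  have h : HasFDerivAt (fun y : E4 => y j) (EuclideanSpace.proj j : E4 →L[ℝ] ℝ) x :=
    (EuclideanSpace.proj j : E4 →L[ℝ] ℝ).hasFDerivAt
  simp [pd, h.fderiv, e4_apply]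

lemma inner_e4 (x : E4) (i : Fin 4) : ⟪x, e4 i⟫ = x i := by
  rw [e4, EuclideanSpace.inner_single_right]
  simp

lemma differentiable_norm_sq : Differentiable ℝ (fun y : E4 => ‖y‖ ^ 2) :=
  fun x => (hasStrictFDerivAt_norm_sq x).hasFDerivAt.differentiableAt

lemma pd_norm_sq (i : Fin 4) (x : E4) : pd i (fun y : E4 => ‖y‖ ^ 2) x = 2 * x i := by
  simp [pd, inner_e4]

lemma norm_sq_eq_sum (x : E4) : ‖x‖ ^ 2 = ∑ j, x j * x j := by
  simp [EuclideanSpace.real_norm_sq_eq, ← sq]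

lemma pd_radial {u : E4 → ℝ} (h : ContDiff ℝ 2 u) (i : Fin 4) :
    pd i (fun y => fderiv ℝ u y y) = fun y => pd i u y + ∑ j, y j * pd i (pd j u) y := by
  have d1 (j) : Differentiable ℝ (pd j u) :=
    (contDiff_pd h (m := 1) (by norm_num) j).differentiable (by norm_num)
  ext y
  simp_rw [fderiv_apply_eq_sum_pd u]
  rw [pd_sum fun j => (differentiable_coord j y).fun_mul (d1 j y)]
  simp_rw [pd_mul (differentiable_coord _ y) (d1 _ y), pd_coord]
  simp [Finset.sum_add_distrib]

/-- The Laplacian of the radial derivative: `Δ(E u) = E(Δu) + 2Δu`. -/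
lemma lap_radial {u : E4 → ℝ} (h : ContDiff ℝ 3 u) (x : E4) :
    lap (fun y => fderiv ℝ u y y) x = fderiv ℝ (lap u) x x + 2 * lap u x := by
  have h1 (j) : ContDiff ℝ 2 (pd j u) := contDiff_pd h (by norm_num) j
  have h2 (i j) : ContDiff ℝ 1 (pd i (pd j u)) := contDiff_pd (h1 j) (by norm_num) i
  have d1 (j) : Differentiable ℝ (pd j u) := (h1 j).differentiable (by norm_num)
  have d2 (i j) : Differentiable ℝ (pd i (pd j u)) := (h2 i j).differentiable (by norm_num)
  have hu2 : ContDiff ℝ 2 u := h.of_le (by norm_num)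
  have second (i) : pd i (pd i (fun y => fderiv ℝ u y y)) x
      = 2 * pd i (pd i u) x + ∑ j, x j * pd j (pd i (pd i u)) x := by
    rw [pd_radial hu2, pd_add (d1 i x)
      (DifferentiableAt.fun_sum fun j _ => (differentiable_coord j x).fun_mul (d2 i j x)),
      pd_sum fun j => (differentiable_coord j x).fun_mul (d2 i j x)]
    simp_rw [pd_mul (differentiable_coord _ x) (d2 _ _ x), pd_coord]
    have hc (j) : pd i (pd i (pd j u)) = pd j (pd i (pd i u)) := by
      rw [pd_comm hu2 i j, pd_comm (h1 i) i j]
    simp_rw [hc]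
    simp [Finset.sum_add_distrib]
    ring
  rw [lap_eq_sum_pd]
  simp_rw [second]
  rw [fderiv_apply_eq_sum_pd]
  have hl (j) : pd j (lap u) x = ∑ i, pd j (pd i (pd i u)) x :=
    pd_sum (fun i => d2 i i x) j
  simp_rw [hl, lap_eq_sum_pd u, Finset.sum_add_distrib, Finset.mul_sum]
  rw [Finset.sum_comm, add_comm]

/-- The product rule for `Δ((|x|² - 1) v)`. -/
lemma lap_norm_sq_sub_one_mul {v : E4 → ℝ} {x : E4} (hv : Differentiable ℝ v)
    (hv2 : ∀ i, DifferentiableAt ℝ (pd i v) x) :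
    lap (fun y => (‖y‖ ^ 2 - 1) * v y) x
      = (‖x‖ ^ 2 - 1) * lap v x + 4 * fderiv ℝ v x x + 8 * v x := by
  have dq : Differentiable ℝ (fun y : E4 => ‖y‖ ^ 2 - 1) :=
    differentiable_norm_sq.sub_const 1
  have pq (i) (y : E4) : pd i (fun y : E4 => ‖y‖ ^ 2 - 1) y = 2 * y i := by
    rw [pd_sub (differentiable_norm_sq y) (differentiableAt_const _), pd_norm_sq, pd_const,
      sub_zero]
  have first (i) : pd i (fun y => (‖y‖ ^ 2 - 1) * v y)
      = fun y => 2 * y i * v y + (‖y‖ ^ 2 - 1) * pd i v y := by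
    ext y
    rw [pd_mul (dq y) (hv y), pq]
  have second (i) : pd i (pd i (fun y => (‖y‖ ^ 2 - 1) * v y)) x
      = 2 * v x + 4 * (x i * pd i v x) + (‖x‖ ^ 2 - 1) * pd i (pd i v) x := by
    have dc : DifferentiableAt ℝ (fun y : E4 => 2 * y i) x :=
      (differentiable_coord i x).const_mul 2
    rw [first, pd_add (dc.fun_mul (hv x)) ((dq x).fun_mul (hv2 i)), pd_mul dc (hv x),
      pd_mul (dq x) (hv2 i), pq, pd_mul (differentiableAt_const _) (differentiable_coord i x),
      pd_coord, pd_const]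
    simp
    ring
  rw [lap_eq_sum_pd]
  simp_rw [second]
  rw [fderiv_apply_eq_sum_pd, lap_eq_sum_pd, Finset.sum_add_distrib, Finset.sum_add_distrib,
    ← Finset.mul_sum, ← Finset.mul_sum, ← Finset.mul_sum]
  simp
  ring

lemma convex_B4p : Convex ℝ B4p := by
  rintro x ⟨hx, hx3⟩ y ⟨hy, hy3⟩ a b ha hb hab
  refine ⟨?_, ?_⟩
  · simpa using (convex_closedBall (0 : E4) 1) (by simpa using hx) (by simpa using hy) ha hb hab
  · simp only [PiLp.add_apply, PiLp.smul_apply, smul_eq_mul]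
    positivity

lemma isCompact_B4p : IsCompact B4p := by
  have h : B4p = Metric.closedBall (0 : E4) 1 ∩ {x | 0 ≤ x 3} := by
    ext x
    simp [B4p]
  rw [h]
  exact (isCompact_closedBall _ _).inter_right
    (isClosed_le continuous_const (differentiable_coord 3).continuous)

lemma zero_mem_B4p : (0 : E4) ∈ B4p := by simp [B4p]

/-- First-order condition at a maximum over the half-ball. -/
lemma fderiv_sub_nonpos_of_isMaxOn {W : E4 → ℝ} {x z : E4} (hW : DifferentiableAt ℝ W x)
    (hx : x ∈ B4p) (hz : z ∈ B4p) (hmax : IsMaxOn W B4p x) : fderiv ℝ W x (z - x) ≤ 0 := by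
  refine hmax.localize.hasFDerivWithinAt_nonpos hW.hasFDerivAt.hasFDerivWithinAt
    (mem_posTangentConeAt_of_segment_subset ?_)
  simpa using convex_B4p.segment_subset hx hz

lemma pd_pd_nonpos_of_isLocalMax {W : E4 → ℝ} {x : E4} (hW : Differentiable ℝ W) (i : Fin 4)
    (hW2 : DifferentiableAt ℝ (pd i W) x) (hmax : IsLocalMax W x) : pd i (pd i W) x ≤ 0 := by
  by_contra! hpos
  set f : ℝ → ℝ := fun t => W (x + t • e4 i) with hf
  have hline (t : ℝ) : HasDerivAt (fun t : ℝ => x + t • e4 i) (e4 i) t := by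
    simpa using ((hasDerivAt_id t).smul_const (e4 i)).const_add x
  have hd : deriv f = fun t => pd i W (x + t • e4 i) := by
    ext t
    exact ((hW _).hasFDerivAt.comp_hasDerivAt t (hline t)).deriv
  have hdd : deriv (deriv f) 0 = pd i (pd i W) x := by
    rw [hd]
    have h0 : HasFDerivAt (pd i W) (fderiv ℝ (pd i W) x) (x + (0 : ℝ) • e4 i) := by
      simpa using hW2.hasFDerivAt
    exact (h0.comp_hasDerivAt 0 (hline 0)).deriv
  have hc : ContinuousAt (fun t : ℝ => x + t • e4 i) 0 := (hline 0).continuousAt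
  have hfmax : IsLocalMax f 0 := by
    have : IsLocalMax W (x + (0 : ℝ) • e4 i) := by simpa using hmax
    exact IsMaxFilter.comp_tendsto (g := fun t : ℝ => x + t • e4 i) this hc
  have hfmin : IsLocalMin f 0 := by
    refine isLocalMin_of_deriv_deriv_pos (hdd ▸ hpos) hfmax.deriv_eq_zero ?_
    exact ((hW _).hasFDerivAt.comp_hasDerivAt 0 (hline 0)).continuousAt
  have hconst : f =ᶠ[𝓝 0] fun _ => f 0 := by
    filter_upwards [hfmax, hfmin] with t h1 h2 using le_antisymm h1 h2
  have hz : deriv (deriv f) 0 = 0 := by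
    rw [hconst.deriv.deriv_eq]
    simp
  linarith

lemma isOpen_interior_half_ball : IsOpen {x : E4 | ‖x‖ < 1 ∧ 0 < x 3} :=
  (isOpen_lt continuous_norm continuous_const).inter
    (isOpen_lt continuous_const (differentiable_coord 3).continuous)

/-- Maximum principle on the half-ball, with a Neumann condition on the flat boundary and a
Dirichlet or Robin condition on the spherical one. -/
lemma nonpos_of_lap_eq_zero {w : E4 → ℝ} (hw : Differentiable ℝ w)
    (hw2 : ∀ x : E4, ‖x‖ < 1 → 0 < x 3 → ∀ i, DifferentiableAt ℝ (pd i w) x)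
    (hlap : ∀ x : E4, ‖x‖ < 1 → 0 < x 3 → lap w x = 0)
    (hN : ∀ x : E4, ‖x‖ < 1 → x 3 = 0 → pd 3 w x = 0)
    (hM : ∀ x ∈ Mhs, w x ≤ 0 ∨ fderiv ℝ w x x ≤ -w x) :
    ∀ x ∈ B4p, w x ≤ 0 := by
  have key (ε : ℝ) (hε : 0 < ε) : ∀ x ∈ B4p, w x ≤ 5 * ε := by
    set p : E4 → ℝ := fun y => ε * (y 3 + ‖y‖ ^ 2) with hp
    set W : E4 → ℝ := fun y => w y + p y with hWdef
    have dc := differentiable_coord 3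
    have dn := differentiable_norm_sq
    have dp : Differentiable ℝ p := (dc.add dn).const_mul ε
    have dW : Differentiable ℝ W := hw.add dp
    have pp (i) (y : E4) : pd i p y = ε * ((if 3 = i then 1 else 0) + 2 * y i) := by
      rw [hp, pd_mul (differentiableAt_const _) ((dc y).fun_add (dn y)), pd_const,
        pd_add (dc y) (dn y), pd_coord, pd_norm_sq]
      ring
    have pW (i) : pd i W = fun y => pd i w y + pd i p y := by
      ext y
      exact pd_add (hw y) (dp y) i
    obtain ⟨x, hx, hmax⟩ := isCompact_B4p.exists_isMaxOn ⟨0, zero_mem_B4p⟩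
      dW.continuous.continuousOn
    have hx3 : x 3 ≤ 1 := by
      have h1 := hx.1
      have : x 3 ≤ ‖x‖ := (le_abs_self _).trans (PiLp.norm_apply_le x 3)
      linarith
    have hWx : W x ≤ 5 * ε := by
      rcases hx.1.lt_or_eq with hlt | heq
      · exfalso
        rcases hx.2.lt_or_eq with h3 | h3
        · have hpd (i) : DifferentiableAt ℝ (pd i p) x := by
            have : pd i p = fun y => ε * ((if 3 = i then 1 else 0) + 2 * y i) := by
              ext y
              exact pp i y
            rw [this]
            fun_prop
          have hpp (i) : pd i (pd i p) x = 2 * ε := by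
            have : pd i p = fun y => ε * ((if 3 = i then 1 else 0) + 2 * y i) := by
              ext y
              exact pp i y
            have d1 : DifferentiableAt ℝ (fun y : E4 => 2 * y i) x := by fun_prop
            rw [this, pd_mul (differentiableAt_const _) ((differentiableAt_const _).fun_add d1),
              pd_const, pd_add (differentiableAt_const _) d1, pd_const,
              pd_mul (differentiableAt_const _) (differentiable_coord i x), pd_const, pd_coord]
            simp
            ring
          have hloc : IsLocalMax W x :=
            hmax.isLocalMax (Filter.mem_of_superset
              (isOpen_interior_half_ball.mem_nhds ⟨hlt, h3⟩)
              fun y hy => ⟨hy.1.le, hy.2.le⟩)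
          have hsum : ∑ i, pd i (pd i W) x ≤ 0 := Finset.sum_nonpos fun i _ =>
            pd_pd_nonpos_of_isLocalMax dW i
              (by rw [pW]; exact (hw2 x hlt h3 i).add (hpd i)) hloc
          have hl := hlap x hlt h3
          rw [lap_eq_sum_pd] at hl
          simp_rw [pW, pd_add (hw2 x hlt h3 _) (hpd _), hpp, Finset.sum_add_distrib, hl] at hsum
          simp at hsum
          linarith
        · have hz : x + (1 - ‖x‖) • e4 3 ∈ B4p := by
            constructor
            · refine (norm_add_le _ _).trans ?_
              rw [norm_smul, Real.norm_of_nonneg (by linarith)]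
              simp [e4]
            · simp only [PiLp.add_apply, PiLp.smul_apply, smul_eq_mul, e4_apply, ← h3]
              simp [hlt.le]
          have h := fderiv_sub_nonpos_of_isMaxOn (dW x) hx hz hmax
          rw [add_sub_cancel_left, map_smul, smul_eq_mul] at h
          have h4 : fderiv ℝ W x (e4 3) = ε := by
            change pd 3 W x = ε
            rw [pW]
            simp [hN x hlt h3.symm, pp, ← h3]
          rw [h4] at h
          nlinarith
      · have hpx : p x ≤ 2 * ε := by
          rw [hp]
          simp only [heq]
          nlinarith
        rcases hM x ⟨heq, hx.2⟩ with h0 | h0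
        · rw [hWdef]
          simp only
          linarith
        · have h := fderiv_sub_nonpos_of_isMaxOn (dW x) hx zero_mem_B4p hmax
          rw [zero_sub, map_neg, fderiv_fun_add (hw x) (dp x)] at h
          have hpr : fderiv ℝ p x x = ε * (x 3 + 2) := by
            have hn := norm_sq_eq_sum x
            rw [heq] at hn
            rw [fderiv_apply_eq_sum_pd]
            simp_rw [pp]
            simp [Fin.sum_univ_four] at hn ⊢
            linear_combination (-2 * ε) * hn
          simp only [add_apply, hpr] at h
          rw [hWdef]
          simp only
          nlinarith
    intro y hy
    have h1 : W y ≤ W x := hmax hy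
    have h2 : 0 ≤ p y := by
      have := hy.2
      positivity
    have h3 : W y = w y + p y := rfl
    linarith
  intro x hx
  refine le_of_forall_pos_le_add fun δ hδ => ?_
  have := key (δ / 5) (by positivity) x hx
  linarith

lemma eq_zero_of_lap_eq_zero {w : E4 → ℝ} (hw : Differentiable ℝ w)
    (hw2 : ∀ x : E4, ‖x‖ < 1 → 0 < x 3 → ∀ i, DifferentiableAt ℝ (pd i w) x)
    (hlap : ∀ x : E4, ‖x‖ < 1 → 0 < x 3 → lap w x = 0)
    (hN : ∀ x : E4, ‖x‖ < 1 → x 3 = 0 → pd 3 w x = 0)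
    (hM : ∀ x ∈ Mhs, w x = 0 ∨ fderiv ℝ w x x = -w x) :
    ∀ x ∈ B4p, w x = 0 := by
  intro x hx
  refine le_antisymm (nonpos_of_lap_eq_zero hw hw2 hlap hN
    (fun y hy => (hM y hy).imp le_of_eq le_of_eq) x hx) ?_
  have h := nonpos_of_lap_eq_zero (w := fun y => -w y) hw.neg
    (fun y h1 h2 i => by rw [pd_neg]; exact (hw2 y h1 h2 i).neg)
    (fun y h1 h2 => by rw [lap_neg, hlap y h1 h2, neg_zero])
    (fun y h1 h2 => by rw [pd_neg]; simp [hN y h1 h2])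
    (fun y hy => (hM y hy).imp (fun h => by simp [h])
      (fun h => by simp [fderiv_fun_neg, h])) x hx
  simpa using h

lemma fderiv_tangential_eq_zero {F : E4 → ℝ} (hF : ∀ y : E4, ‖y‖ < 1 → y 3 = 0 → F y = 0)
    {x d : E4} (hx : ‖x‖ < 1) (hx3 : x 3 = 0) (hd : d 3 = 0) : fderiv ℝ F x d = 0 := by
  by_cases hdiff : DifferentiableAt ℝ F x
  swap
  · simp [fderiv_zero_of_not_differentiableAt hdiff]
  have hline : HasDerivAt (fun t : ℝ => x + t • d) d 0 := by
    simpa using ((hasDerivAt_id (0 : ℝ)).smul_const d).const_add x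
  have h0 : HasFDerivAt F (fderiv ℝ F x) (x + (0 : ℝ) • d) := by simpa using hdiff.hasFDerivAt
  have hcomp := h0.comp_hasDerivAt 0 hline
  have hnear : ∀ᶠ t : ℝ in 𝓝 0, ‖x + t • d‖ < 1 :=
    hline.continuousAt.norm.eventually_lt continuousAt_const (by simpa using hx)
  have hev : (F ∘ fun t : ℝ => x + t • d) =ᶠ[𝓝 0] fun _ => 0 := by
    filter_upwards [hnear] with t ht
    exact hF _ ht (by simp [hx3, hd])
  rw [← hcomp.deriv, hev.deriv_eq]
  simp

lemma hasFDerivAt_norm_inv {y : E4} (hy : y ≠ 0) :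
    HasFDerivAt (fun y : E4 => ‖y‖⁻¹) (-(‖y‖⁻¹ ^ 3) • innerSL ℝ y) y := by
  have hn : ‖y‖ ≠ 0 := norm_ne_zero_iff.2 hy
  have h1 : HasFDerivAt (fun y : E4 => ‖y‖) (‖y‖⁻¹ • innerSL ℝ y) y := by
    have h := (hasStrictFDerivAt_norm_sq y).hasFDerivAt.sqrt (pow_ne_zero 2 hn)
    simp only [Real.sqrt_sq (norm_nonneg _)] at h
    refine h.congr_fderiv ?_
    ext z
    simp
    field_simp
  have h2 := (hasDerivAt_inv hn).comp_hasFDerivAt y h1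
  refine h2.congr_fderiv ?_
  ext z
  simp
  ring

lemma pd_norm_inv {y : E4} (hy : y ≠ 0) (i : Fin 4) :
    pd i (fun y : E4 => ‖y‖⁻¹) y = -(‖y‖⁻¹ ^ 3) * y i := by
  simp [pd, (hasFDerivAt_norm_inv hy).fderiv, inner_e4]

lemma hasFDerivAt_normalize {y : E4} (hy : y ≠ 0) :
    HasFDerivAt (fun y : E4 => ‖y‖⁻¹ • y)
      (‖y‖⁻¹ • ContinuousLinearMap.id ℝ E4 + (-(‖y‖⁻¹ ^ 3) • innerSL ℝ y).smulRight y) y :=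
  (hasFDerivAt_norm_inv hy).smul (hasFDerivAt_id y)

/-- Chain rule for the `0`-homogeneous extension. -/
lemma pd_comp_normalize {F : E4 → ℝ} (hF : Differentiable ℝ F) {y : E4} (hy : y ≠ 0)
    (i : Fin 4) : pd i (fun y => F (‖y‖⁻¹ • y)) y
      = ‖y‖⁻¹ * pd i F (‖y‖⁻¹ • y)
        - ‖y‖⁻¹ ^ 3 * y i * ∑ j, y j * pd j F (‖y‖⁻¹ • y) := by
  have h := HasFDerivAt.comp (f := fun y : E4 => ‖y‖⁻¹ • y) y (hF (‖y‖⁻¹ • y)).hasFDerivAt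
    (hasFDerivAt_normalize hy)
  have h' : fderiv ℝ (fun y => F (‖y‖⁻¹ • y)) y = _ := h.fderiv
  rw [pd, h', ← fderiv_apply_eq_sum_pd]
  simp only [ContinuousLinearMap.comp_apply, add_apply, smul_apply,
    ContinuousLinearMap.id_apply, ContinuousLinearMap.smulRight_apply, innerSL_apply_apply,
    inner_e4, map_add, map_smul, smul_eq_mul, pd]
  ring

/-- The spherical Laplacian at a unit vector where the radial derivative vanishes. -/
lemma sphLap_eq {u : E4 → ℝ} (h : ContDiff ℝ 2 u) {x : E4} (hx : ‖x‖ = 1)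
    (hu : fderiv ℝ u x x = 0) :
    sphLap u x = lap u x - fderiv ℝ (fun y => fderiv ℝ u y y) x x := by
  have hx0 : x ≠ 0 := norm_ne_zero_iff.1 (by rw [hx]; exact one_ne_zero)
  have d0 : Differentiable ℝ u := h.differentiable (by norm_num)
  have d1 (j) : Differentiable ℝ (pd j u) :=
    (contDiff_pd h (m := 1) (by norm_num) j).differentiable (by norm_num)
  have ds : DifferentiableAt ℝ (fun y : E4 => ‖y‖⁻¹) x :=
    (hasFDerivAt_norm_inv hx0).differentiableAt
  have dA (j) : DifferentiableAt ℝ (fun y : E4 => pd j u (‖y‖⁻¹ • y)) x :=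
    DifferentiableAt.comp (f := fun y : E4 => ‖y‖⁻¹ • y) x (d1 j _)
      (hasFDerivAt_normalize hx0).differentiableAt
  have hsx : ‖x‖⁻¹ • x = x := by simp [hx]
  have dyA (j) : DifferentiableAt ℝ (fun y : E4 => y j * pd j u (‖y‖⁻¹ • y)) x :=
    (differentiable_coord j x).fun_mul (dA j)
  have ds3 : DifferentiableAt ℝ (fun y : E4 => ‖y‖⁻¹ ^ 3) x := ds.fun_pow 3
  have pA (i j) : pd i (fun y => pd j u (‖y‖⁻¹ • y)) x
      = pd i (pd j u) x - x i * ∑ k, x k * pd k (pd j u) x := by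
    rw [pd_comp_normalize (d1 j) hx0, hsx, hx]
    simp
  have hu' : ∑ j, x j * pd j u x = 0 := by rw [← fderiv_apply_eq_sum_pd, hu]
  have hq : ∑ i, x i * x i = 1 := by rw [← norm_sq_eq_sum, hx, one_pow]
  set Q : Fin 4 → ℝ := fun i => ∑ k, x k * pd k (pd i u) x with hQ
  have hQ' (i) : ∑ k, x k * pd i (pd k u) x = Q i := by
    simp_rw [hQ, pd_comm h i]
  have second (i) : pd i (pd i (fun y => u (‖y‖⁻¹ • y))) x
      = pd i (pd i u) x - 2 * (x i * pd i u x) - 2 * (x i * Q i)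
        + (x i * x i) * ∑ j, x j * Q j := by
    have hev : pd i (fun y => u (‖y‖⁻¹ • y)) =ᶠ[𝓝 x] fun y => ‖y‖⁻¹ * pd i u (‖y‖⁻¹ • y)
        - ‖y‖⁻¹ ^ 3 * y i * ∑ j, y j * pd j u (‖y‖⁻¹ • y) := by
      filter_upwards [isOpen_ne.mem_nhds hx0] with y hy using pd_comp_normalize d0 hy i
    have dS := DifferentiableAt.fun_sum (u := Finset.univ) fun j _ => dyA j
    rw [pd, hev.fderiv_eq, ← pd, pd_sub (ds.fun_mul (dA i))
      ((ds3.fun_mul (differentiable_coord i x)).fun_mul dS), pd_mul ds (dA i),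
      pd_mul (ds3.fun_mul (differentiable_coord i x)) dS, pd_sum dyA, pd_norm_inv hx0]
    simp_rw [pd_mul (differentiable_coord _ x) (dA _), pA, pd_coord, hsx]
    rw [hu', hx]
    have e1 : ∑ j, x j * (pd i (pd j u) x - x i * Q j) = Q i - x i * ∑ j, x j * Q j := by
      rw [← hQ' i, Finset.mul_sum, ← Finset.sum_sub_distrib]
      exact Finset.sum_congr rfl fun j _ => by ring
    rw [Finset.sum_add_distrib, e1]
    simp
    ring
  have hrad : fderiv ℝ (fun y => fderiv ℝ u y y) x x = ∑ j, x j * Q j := by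
    rw [fderiv_apply_eq_sum_pd]
    simp_rw [pd_radial h, hQ', mul_add, Finset.sum_add_distrib, hu', zero_add]
  rw [sphLap, lap_eq_sum_pd, hrad]
  simp_rw [second]
  rw [Finset.sum_add_distrib, Finset.sum_sub_distrib, Finset.sum_sub_distrib, ← Finset.mul_sum,
    ← Finset.mul_sum, ← Finset.sum_mul, hq, hu', lap_eq_sum_pd]
  ring

lemma lap_eq_zero_of_eventuallyEq_zero {f : E4 → ℝ} {x : E4} (h : f =ᶠ[𝓝 x] fun _ => 0) :
    lap f x = 0 := by
  rw [lap_eq_sum_pd]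
  refine Finset.sum_eq_zero fun i _ => ?_
  have h1 : pd i f =ᶠ[𝓝 x] fun _ => 0 := by
    filter_upwards [h.fderiv (𝕜 := ℝ)] with y hy
    simp [pd, hy]
  rw [pd, h1.fderiv_eq]
  simp

lemma sphLap_muM_eq_zero {u : E4 → ℝ} (hu : ∀ x ∈ Mhs, muM u x = 0) {x : E4}
    (hx3 : 0 < x 3) : sphLap (muM u) x = 0 := by
  refine lap_eq_zero_of_eventuallyEq_zero ?_
  filter_upwards [(isOpen_lt continuous_const (differentiable_coord 3).continuous).mem_nhds hx3]
    with y hy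
  have hy0 : y ≠ 0 := by
    rintro rfl
    simp at hy
  have hy3 : 0 < y 3 := hy
  refine hu _ ⟨norm_smul_inv_norm hy0, ?_⟩
  simp only [PiLp.smul_apply, smul_eq_mul]
  positivity

lemma lap3_muN_eq_zero {u : E4 → ℝ} (hu : ∀ x ∈ Nfb, muN u x = 0) {x : E4}
    (hx : ‖x‖ < 1) (hx3 : x 3 = 0) : lap3 (muN u) x = 0 := by
  have he (i : Fin 3) : e4 i.castSucc 3 = 0 := by
    fin_cases i <;> simp [e4_apply]
  refine Finset.sum_eq_zero fun i _ => fderiv_tangential_eq_zero (fun y hy hy3 => ?_) hx hx3 (he i)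
  exact fderiv_tangential_eq_zero (fun z hz hz3 => hu z ⟨hz.le, hz3⟩) hy hy3 (he i)

/-- The complement of the corner is dense in the half-sphere. -/
lemma Mhs_subset_closure : Mhs ⊆ closure (Mhs \ Sig) := by
  rintro p ⟨hp, hp3⟩
  rcases hp3.lt_or_eq with h3 | h3
  · exact subset_closure ⟨⟨hp, hp3⟩, fun h => h3.ne' h.2⟩
  set γ : ℝ → E4 := fun t => Real.cos t • p + Real.sin t • e4 3 with hγ
  have hcont : Filter.Tendsto γ (𝓝[>] 0) (𝓝 p) := by
    have : Continuous γ := by fun_prop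
    have h0 : γ 0 = p := by simp [hγ]
    exact h0 ▸ this.continuousAt.continuousWithinAt.tendsto
  refine mem_closure_of_tendsto hcont ?_
  filter_upwards [Ioo_mem_nhdsGT Real.pi_pos] with t ht
  have hs := Real.sin_pos_of_mem_Ioo ht
  have hγ3 : γ t 3 = Real.sin t := by simp [hγ, ← h3, e4_apply]
  have hnorm : ‖γ t‖ = 1 := by
    have horth : ⟪p, e4 3⟫ = 0 := by rw [inner_e4, ← h3]
    have : ‖γ t‖ ^ 2 = 1 := by
      rw [hγ]
      simp only
      rw [norm_add_sq_real, norm_smul, norm_smul, inner_smul_left, inner_smul_right, horth, hp]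
      simp [e4]
    exact (pow_eq_one_iff_of_nonneg (norm_nonneg _) two_ne_zero).1 this
  exact ⟨⟨hnorm, hγ3 ▸ hs.le⟩, fun h => hs.ne' (hγ3 ▸ h.2)⟩

/-- A function vanishing on the half-ball has vanishing radial derivative on it. -/
lemma fderiv_self_eq_zero {w : E4 → ℝ} (hw : Differentiable ℝ w)
    (h : ∀ x ∈ B4p, w x = 0) {x : E4} (hx : x ∈ B4p) : fderiv ℝ w x x = 0 := by
  have h1 := fderiv_sub_nonpos_of_isMaxOn (hw x) hx zero_mem_B4p
    (fun y hy => by simp [h x hx, h y hy])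
  have h2 := fderiv_sub_nonpos_of_isMaxOn (hw.neg x) hx zero_mem_B4p
    (fun y hy => by simp [h x hx, h y hy])
  simp [fderiv_neg] at h1 h2
  linarith

/-- A function with vanishing radial derivative on the half-ball is constant on it. -/
lemma eq_apply_zero_of_radial {u : E4 → ℝ} (hu : Differentiable ℝ u)
    (h : ∀ x ∈ B4p, fderiv ℝ u x x = 0) {x : E4} (hx : x ∈ B4p) : u x = u 0 := by
  have hline (t : ℝ) : HasDerivAt (fun t : ℝ => t • x) x t := by
    simpa using (hasDerivAt_id t).smul_const x
  have hd (t : ℝ) : HasDerivAt (fun t : ℝ => u (t • x)) (fderiv ℝ u (t • x) x) t :=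
    (hu (t • x)).hasFDerivAt.comp_hasDerivAt t (hline t)
  obtain ⟨c, hc, heq⟩ := exists_hasDerivAt_eq_slope (fun t : ℝ => u (t • x)) _ zero_lt_one
    (fun t _ => (hd t).continuousAt.continuousWithinAt) (fun t _ => hd t)
  have hcx : c • x ∈ B4p := by
    simpa using convex_B4p zero_mem_B4p hx (sub_nonneg.2 hc.2.le) hc.1.le (by ring)
  have h0 := h _ hcx
  rw [map_smul, smul_eq_mul] at h0
  have h1 := (mul_eq_zero.1 h0).resolve_left hc.1.ne'
  rw [h1] at heq
  simp at heq
  linarith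

/-- Uniqueness for the homogeneous boundary value problem on the half-ball: a function
`ω`, of class `C³` up to the boundary of the closed half-ball (encoded as globally `C³`),
four times continuously differentiable and biharmonic in the interior, satisfying
`P₃^M ω = 0` on `M \ Σ`, `P₃^N ω = 0` on `N \ Σ`, `μ_M ω = 0` on `M`, `μ_N ω = 0` on `N`,
and `ω = 0` on `Σ`, vanishes identically on `B⁴₊`. -/
theorem stmt1 (ω : E4 → ℝ)
    (hreg : ContDiff ℝ 3 ω)
    (hint : ContDiffOn ℝ 4 ω {x : E4 | ‖x‖ < 1 ∧ 0 < x 3})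
    (hbih : ∀ x : E4, ‖x‖ < 1 → 0 < x 3 → lap (lap ω) x = 0)
    (hM : ∀ x ∈ Mhs \ Sig, P3M ω x = 0)
    (hN : ∀ x ∈ Nfb \ Sig, P3N ω x = 0)
    (hmuM : ∀ x ∈ Mhs, muM ω x = 0)
    (hmuN : ∀ x ∈ Nfb, muN ω x = 0)
    (hSig : ∀ p ∈ Sig, ω p = 0) :
    ∀ x ∈ B4p, ω x = 0 := by
  set v : E4 → ℝ := lap ω with hv
  have hω2 : ContDiff ℝ 2 ω := hreg.of_le (by norm_num)
  have hω : Differentiable ℝ ω := hreg.differentiable (by norm_num)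
  have hv1 : ContDiff ℝ 1 v := contDiff_lap hreg (by norm_num)
  have dv : Differentiable ℝ v := hv1.differentiable (by norm_num)
  have hv2 (x : E4) (hx : ‖x‖ < 1) (hx3 : 0 < x 3) (i : Fin 4) :
      DifferentiableAt ℝ (pd i v) x := by
    have h4 : ContDiffAt ℝ 4 ω x :=
      hint.contDiffAt (isOpen_interior_half_ball.mem_nhds ⟨hx, hx3⟩)
    have h2 : ContDiffAt ℝ 2 v x := contDiffAt_lap h4 (by norm_num)
    exact (contDiffAt_pd h2 (m := 1) (by norm_num) i).differentiableAt (by norm_num)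
  have hvN (x : E4) (hx : ‖x‖ < 1) (hx3 : x 3 = 0) : pd 3 v x = 0 := by
    have h := hN x ⟨⟨hx.le, hx3⟩, fun h => hx.ne h.1⟩
    rw [P3N, lap3_muN_eq_zero hmuN hx hx3] at h
    have : muN v x = 0 := by linarith
    exact this
  set R : E4 → ℝ := fun y => fderiv ℝ ω y y with hR
  have hR2 : ContDiff ℝ 2 R := (hreg.fderiv_right (by norm_num)).clm_apply contDiff_id
  have dR : Differentiable ℝ R := hR2.differentiable (by norm_num)
  have hRM : ∀ x ∈ Mhs, R x = 0 := fun x hx => neg_eq_zero.1 (hmuM x hx)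
  have hRN (x : E4) (hx : ‖x‖ < 1) (hx3 : x 3 = 0) : pd 3 R x = 0 := by
    have h1 : pd 3 ω x = 0 := hmuN x ⟨hx.le, hx3⟩
    have h2 : fderiv ℝ (pd 3 ω) x x = 0 :=
      fderiv_tangential_eq_zero (fun y hy hy3 => hmuN y ⟨hy.le, hy3⟩) hx hx3 hx3
    rw [fderiv_apply_eq_sum_pd] at h2
    rw [hR, pd_radial hω2]
    simp_rw [pd_comm hω2 3]
    rw [h1, h2, add_zero]
  set q : E4 → ℝ := fun y => (‖y‖ ^ 2 - 1) * v y with hq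
  have dn : Differentiable ℝ (fun y : E4 => ‖y‖ ^ 2 - 1) := differentiable_norm_sq.sub_const 1
  have dq : Differentiable ℝ q := dn.mul dv
  have pq (i : Fin 4) (x : E4) : pd i q x = 2 * x i * v x + (‖x‖ ^ 2 - 1) * pd i v x := by
    rw [hq, pd_mul (dn x) (dv x), pd_sub (differentiable_norm_sq x) (differentiableAt_const _),
      pd_norm_sq, pd_const, sub_zero]
  have hq2 (x : E4) (hx : ‖x‖ < 1) (hx3 : 0 < x 3) (i : Fin 4) :
      DifferentiableAt ℝ (pd i q) x := by
    rw [show pd i q = _ from funext (pq i)]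
    exact (((differentiable_coord i x).const_mul 2).mul (dv x)).add
      ((dn x).mul (hv2 x hx hx3 i))
  set w : E4 → ℝ := fun y => 4 * R y - q y with hw
  have d4R : Differentiable ℝ (fun y => 4 * R y) := dR.const_mul 4
  have dw : Differentiable ℝ w := d4R.sub dq
  have pw (i : Fin 4) : pd i w = fun y => 4 * pd i R y - pd i q y := by
    ext y
    rw [hw, pd_sub (d4R y) (dq y), pd_mul (differentiableAt_const _) (dR y), pd_const]
    ring
  have dpR (i : Fin 4) : Differentiable ℝ (pd i R) :=
    (contDiff_pd hR2 (m := 1) (by norm_num) i).differentiable (by norm_num)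
  have hw0 : ∀ x ∈ B4p, w x = 0 := by
    refine eq_zero_of_lap_eq_zero dw (fun x hx hx3 i => ?_) (fun x hx hx3 => ?_)
      (fun x hx hx3 => ?_) (fun x hx => Or.inl ?_)
    · rw [pw]
      exact ((dpR i x).const_mul 4).sub (hq2 x hx hx3 i)
    · have h1 : lap w x = 4 * lap R x - lap q x := by
        simp_rw [lap_eq_sum_pd, pw, Finset.mul_sum, ← Finset.sum_sub_distrib]
        refine Finset.sum_congr rfl fun i _ => ?_
        rw [pd_sub ((dpR i x).const_mul 4) (hq2 x hx hx3 i),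
          pd_mul (differentiableAt_const _) (dpR i x), pd_const]
        ring
      rw [h1, hR, lap_radial hreg, hq, lap_norm_sq_sub_one_mul dv (hv2 x hx hx3),
        hbih x hx hx3]
      ring
    · rw [pw]
      simp [hRN x hx hx3, pq, hvN x hx hx3, hx3]
    · simp [hw, hq, hRM x hx, hx.1]
  have hvM' : ∀ x ∈ Mhs \ Sig, fderiv ℝ v x x = -v x := by
    intro x hx
    have hx3 : 0 < x 3 := lt_of_le_of_ne hx.1.2 fun h => hx.2 ⟨hx.1.1, h.symm⟩
    have hwx := fderiv_self_eq_zero dw hw0 (x := x) ⟨hx.1.1.le, hx.1.2⟩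
    have hqx : fderiv ℝ q x x = 2 * v x := by
      have hn := norm_sq_eq_sum x
      rw [hx.1.1] at hn
      rw [fderiv_apply_eq_sum_pd]
      simp_rw [pq, hx.1.1]
      simp [Fin.sum_univ_four] at hn ⊢
      linear_combination (-2 * v x) * hn
    have hRx : fderiv ℝ R x x = v x / 2 := by
      rw [fderiv_apply_eq_sum_pd] at hwx hqx ⊢
      simp_rw [pw, mul_sub, Finset.sum_sub_distrib, hqx] at hwx
      simp_rw [mul_left_comm _ (4 : ℝ), ← Finset.mul_sum] at hwx
      linarith
    have h := hM x hx
    rw [P3M, sphLap_muM_eq_zero hmuM hx3, sphLap_eq hω2 hx.1.1 (hRM x hx.1), muM] at h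
    linarith
  have hvM : ∀ x ∈ Mhs, fderiv ℝ v x x = -v x := by
    intro x hx
    have hc : Continuous fun y => fderiv ℝ v y y :=
      (hv1.continuous_fderiv (by norm_num)).clm_apply continuous_id
    exact closure_minimal (s := Mhs \ Sig) (t := {y | fderiv ℝ v y y = -v y}) hvM'
      (isClosed_eq hc hv1.continuous.neg) (Mhs_subset_closure hx)
  have hv0 : ∀ x ∈ B4p, v x = 0 :=
    eq_zero_of_lap_eq_zero dv hv2 hbih hvN fun x hx => Or.inr (hvM x hx)
  have hR0 : ∀ x ∈ B4p, R x = 0 := by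
    intro x hx
    have h := hw0 x hx
    simp only [hw, hq, hv0 x hx] at h
    linarith
  have hconst {x : E4} (hx : x ∈ B4p) : ω x = ω 0 := eq_apply_zero_of_radial hω hR0 hx
  have hp : e4 0 ∈ Sig := ⟨by simp [e4], by simp [e4_apply]⟩
  intro x hx
  rw [hconst hx, ← hconst ⟨hp.1.le, hp.2.ge⟩, hSig _ hp]
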